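/- Let P(m,n) = a m² + b m n + c n² + d m + e n + f₀ be an integral bivariate quadratic polynomial whose discriminant Δ = b² − 4ac is either negative, or positive and not a perfect square. Let 1 ≤ p < ∞ and λ > 1 − 1/(2p). Then there is a constant C (depending only on λ, p, Δ — in particular, not on d, e, f₀) such that for every nonnegative f : ℤ → [0,∞], ∑_{n∈ℤ} ( ∑_{m∈ℤ, m≠0} f(P(m,n)) / |m|^λ )^p ≤ C^p · ∑_{k∈ℤ} f(k)^p (all sums taken in the extended nonnegative reals). -/

import Mathlib

open scoped ENNReal

open scoped NumberTheorySymbols in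
theorem exists_prime_jacobiSym_eq_neg_one {Δ : ℤ} (h0 : Δ ≠ 0) (hΔ : ¬ IsSquare Δ) :
    ∃ q : ℕ, q.Prime ∧ q ≠ 2 ∧ J(Δ | q) = -1 := by
  obtain ⟨a, r, hra, hsq⟩ := Nat.sq_mul_squarefree Δ.natAbs
  have hN : Δ.natAbs ≠ 0 := by simpa using h0
  have hr0 : r ≠ 0 := by rintro rfl; simp at hra; exact h0 (by omega)
  have ha0 : a ≠ 0 := hsq.ne_zero
  obtain ⟨s, hs, hsΔ⟩ : ∃ s : ℤ, (s = 1 ∨ s = -1) ∧ Δ = s * a * (r : ℤ) ^ 2 := by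
    have hc : (Δ.natAbs : ℤ) = (r : ℤ) ^ 2 * a := by exact_mod_cast hra.symm
    rcases Int.natAbs_eq Δ with h | h
    · exact ⟨1, Or.inl rfl, by rw [h, hc]; ring⟩
    · exact ⟨-1, Or.inr rfl, by rw [h, hc]; ring⟩
  suffices H : ∃ q : ℕ, q.Prime ∧ q ≠ 2 ∧ r < q ∧ J(s * a | q) = -1 by
    obtain ⟨q, hq, hq2, hrq, hJ⟩ := H
    refine ⟨q, hq, hq2, ?_⟩
    rw [hsΔ, jacobiSym.mul_left, hJ, jacobiSym.sq_one', mul_one]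
    rw [Int.gcd_natCast_natCast]
    exact (Nat.Coprime.symm ((Nat.Prime.coprime_iff_not_dvd hq).2
      (fun h => absurd (Nat.le_of_dvd (Nat.pos_of_ne_zero hr0) h) (by omega))))
  by_cases hodd : ∃ p : ℕ, p.Prime ∧ p ≠ 2 ∧ p ∣ a
  · obtain ⟨p, hp, hp2, a', rfl⟩ := hodd
    have : Fact p.Prime := ⟨hp⟩
    have hpa : p.Coprime a' := Nat.coprime_of_squarefree_mul hsq
    have hp4 : p.Coprime (4 * a') := by
      refine Nat.Coprime.mul_right ?_ hpa
      have : p.Coprime 2 := (Nat.coprime_primes hp Nat.prime_two).2 hp2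
      simpa using this.pow_right 2
    obtain ⟨u, hu⟩ := FiniteField.exists_nonsquare (F := ZMod p) (by simpa [ZMod.ringChar_zmod_n] using hp2)
    obtain ⟨v, hv1, hv2⟩ := Nat.chineseRemainder hp4 u.val 1
    have hvp : (v : ZMod p) = u := by
      rw [(ZMod.natCast_eq_natCast_iff _ _ _).2 hv1]; simp
    have hu0 : u ≠ 0 := by rintro rfl; exact hu (IsSquare.zero)
    have hcop : v.Coprime (p * (4 * a')) := by
      refine Nat.Coprime.mul_right ?_ ?_
      · refine Nat.Coprime.symm ((Nat.Prime.coprime_iff_not_dvd hp).2 fun h => hu0 ?_)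
        rw [← hvp]; exact (ZMod.natCast_eq_zero_iff _ _).2 h
      · rw [Nat.Coprime, hv2.gcd_eq]; simp
    have hane : a' ≠ 0 := by rintro rfl; simp at ha0
    obtain ⟨q, hqr, hq, hqv⟩ := Nat.forall_exists_prime_gt_and_modEq (r + 2)
      (q := p * (4 * a')) (a := v) (by simp [hp.ne_zero, hane]) hcop
    have hq2 : q ≠ 2 := by omega
    have hqodd : Odd q := hq.odd_of_ne_two hq2
    refine ⟨q, hq, hq2, by omega, ?_⟩
    have h4a : q ≡ 1 [MOD 4 * a'] := (hqv.of_mul_left p).trans hv2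
    have h4 : q % 4 = 1 := h4a.of_mul_right a'
    have hqu : ((q : ℤ) : ZMod p) = u := by
      rw [← hvp, Int.cast_natCast]
      exact (ZMod.natCast_eq_natCast_iff _ _ _).2 (hqv.of_mul_right (4 * a'))
    have h1 : J(p | q) = -1 := by
      rw [jacobiSym.quadratic_reciprocity_one_mod_four' (hp.odd_of_ne_two hp2) h4,
        ZMod.nonsquare_iff_jacobiSym_eq_neg_one, hqu]
      exact hu
    have h2 : J(s * a' | q) = 1 := by
      have hna : (s * a' : ℤ).natAbs = a' := by rcases hs with rfl | rfl <;> simp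
      rw [jacobiSym.mod_right _ hqodd, hna, h4a, Nat.mod_eq_of_lt (by omega), jacobiSym.one_right]
    rw [Nat.cast_mul, mul_left_comm, jacobiSym.mul_left, h1, h2]
    norm_num
  · push Not at hodd
    have h2 := Nat.eq_prime_pow_of_unique_prime_dvd ha0 (p := 2)
      (fun {d} hd hda => by_contra fun h => hodd d hd h hda)
    have ha12 : a = 1 ∨ a = 2 := by
      have hle : a.primeFactorsList.length ≤ 1 := by
        by_contra hcon
        have h4 : 2 * 2 ∣ a := by
          rw [h2]; exact (pow_dvd_pow 2 (by omega : 2 ≤ a.primeFactorsList.length))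
        simpa using hsq 2 h4
      rcases Nat.le_one_iff_eq_zero_or_eq_one.1 hle with h | h <;> rw [h] at h2 <;> simp [h2]
    have key (c : ℕ) (hc : Nat.Coprime c 8) (hc8 : c < 8)
        (hJ : J(s * a | c % (4 * a)) = -1) :
        ∃ q : ℕ, q.Prime ∧ q ≠ 2 ∧ r < q ∧ J(s * a | q) = -1 := by
      obtain ⟨q, hqr, hq, hqv⟩ := Nat.forall_exists_prime_gt_and_modEq (r + 2)
        (q := 8) (a := c) (by norm_num) hc
      have hq2 : q ≠ 2 := by omega
      refine ⟨q, hq, hq2, by omega, ?_⟩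
      have hna : (s * a : ℤ).natAbs = a := by rcases hs with rfl | rfl <;> simp
      have h4a : 4 * a ∣ 8 := by rcases ha12 with rfl | rfl <;> norm_num
      rw [jacobiSym.mod_right _ (hq.odd_of_ne_two hq2), hna, hqv.of_dvd h4a]
      exact hJ
    rcases hs with rfl | rfl <;> rcases ha12 with rfl | rfl
    · exact absurd ⟨(r : ℤ), by rw [hsΔ]; push_cast; ring⟩ hΔ
    · exact key 5 (by norm_num) (by norm_num) (by norm_num)
    · exact key 7 (by norm_num) (by norm_num) (by norm_num)
    · exact key 7 (by norm_num) (by norm_num) (by norm_num)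

open scoped NumberTheorySymbols in
theorem exists_residueClass_nonsquare {Δ : ℤ} (h0 : Δ ≠ 0) (hΔ : ¬ IsSquare Δ) :
    ∃ (D : ℕ) (_ : NeZero D) (a : ZMod D), IsUnit a ∧
      ∀ q : ℕ, q.Prime → (q : ZMod D) = a → q ≠ 2 ∧ ¬ IsSquare (Δ : ZMod q) := by
  obtain ⟨q, hq, hq2, hJ⟩ := exists_prime_jacobiSym_eq_neg_one h0 hΔ
  have hD : 4 * Δ.natAbs ≠ 0 := by simpa using h0
  have hqodd := hq.odd_of_ne_two hq2
  refine ⟨4 * Δ.natAbs, ⟨hD⟩, (q : ZMod _), ?_, fun q' hq' hqq => ?_⟩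
  · refine (ZMod.isUnit_iff_coprime _ _).2 (Nat.Coprime.mul_right ?_ ?_)
    · simpa using (Nat.coprime_two_right.2 hqodd).pow_right 2
    · have : Δ.gcd q = 1 := by
        by_contra h
        have := jacobiSym.eq_zero_iff.2 ⟨hq.ne_zero, h⟩
        omega
      rw [Nat.coprime_comm]
      simpa [Int.gcd] using this
  · have hmod := (ZMod.natCast_eq_natCast_iff _ _ _).1 hqq
    have h2 : q' % 2 = q % 2 := hmod.of_dvd ⟨2 * Δ.natAbs, by ring⟩
    have hodd : Odd q' := by rw [Nat.odd_iff] at *; omega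
    have : Fact q'.Prime := ⟨hq'⟩
    refine ⟨by rintro rfl; exact absurd hodd (by decide), ?_⟩
    rw [← ZMod.nonsquare_iff_jacobiSym_eq_neg_one, jacobiSym.mod_right _ hodd, hmod,
      ← jacobiSym.mod_right _ hqodd, hJ]

theorem sum_rpow_neg_le_of_card_le {θ γ c : ℝ} (hθ : 0 < θ) (hγ : θ < γ) (hc : 0 < c) :
    ∃ C : ℝ, ∀ T : Finset ℕ, (∀ n ∈ T, 1 ≤ n) →
      (∀ n ∈ T, ((T.filter (· ≤ n)).card : ℝ) ≤ c * (n : ℝ) ^ θ) →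
      ∑ n ∈ T, (n : ℝ) ^ (-γ) ≤ C := by
  have hs : Summable fun i : ℕ => (i : ℝ) ^ (-(γ / θ)) :=
    Real.summable_nat_rpow.2 (by rw [neg_lt_neg_iff, one_lt_div hθ]; exact hγ)
  refine ⟨c ^ (γ / θ) * ∑' i : ℕ, (i : ℝ) ^ (-(γ / θ)), fun T hT hcard => ?_⟩
  have hpt : ∀ n ∈ T, (n : ℝ) ^ (-γ) ≤
      c ^ (γ / θ) * ((T.filter (· ≤ n)).card : ℝ) ^ (-(γ / θ)) := by
    intro n hn
    have hn0 : (0 : ℝ) < n := by exact_mod_cast hT n hn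
    have hr0 : (0 : ℝ) < (T.filter (· ≤ n)).card := by
      exact_mod_cast Finset.card_pos.2 ⟨n, by simp [hn]⟩
    have h1 := Real.rpow_le_rpow_of_nonpos hr0 (hcard n hn)
      (show -(γ / θ) ≤ 0 by have := div_pos (hθ.trans hγ) hθ; linarith)
    rw [Real.mul_rpow hc.le (by positivity), ← Real.rpow_mul hn0.le] at h1
    have h2 : θ * -(γ / θ) = -γ := by field_simp
    rw [h2, Real.rpow_neg hc.le] at h1
    have h3 : 0 < c ^ (γ / θ) := by positivity
    calc (n : ℝ) ^ (-γ) = c ^ (γ / θ) * ((c ^ (γ / θ))⁻¹ * (n : ℝ) ^ (-γ)) := by field_simp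
      _ ≤ _ := by gcongr
  refine (Finset.sum_le_sum hpt).trans ?_
  rw [← Finset.mul_sum]
  gcongr
  have hinj : Set.InjOn (fun n => (T.filter (· ≤ n)).card) T := by
    have hlt : ∀ a ∈ T, ∀ b ∈ T, a < b →
        (T.filter (· ≤ a)).card < (T.filter (· ≤ b)).card := by
      intro a _ b hb hab
      refine Finset.card_lt_card (Finset.ssubset_iff_of_subset ?_ |>.2 ⟨b, by simp [hb], by simp [hab]⟩)
      intro x hx
      simp only [Finset.mem_filter] at *
      exact ⟨hx.1, hx.2.trans hab.le⟩
    intro a ha b hb hab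
    rcases lt_trichotomy a b with h | h | h
    · exact absurd hab (hlt a ha b hb h).ne
    · exact h
    · exact absurd hab (hlt b hb a ha h).ne'
  rw [← Finset.sum_image (f := fun i : ℕ => (i : ℝ) ^ (-(γ / θ))) hinj]
  exact hs.sum_le_tsum _ fun i _ => by positivity

theorem card_isSquare_quadratic_le {q : ℕ} [Fact q.Prime] (hq : 12 ≤ q) {δ : ZMod q}
    (hδ : ¬ IsSquare δ) (β γ : ZMod q) [DecidablePred fun m : ZMod q => IsSquare (δ * m ^ 2 + β * m + γ)] :
    4 * (Finset.univ.filter fun m : ZMod q => IsSquare (δ * m ^ 2 + β * m + γ)).card ≤ 3 * q := by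
  classical
  set R := Finset.univ.filter fun m : ZMod q => IsSquare (δ * m ^ 2 + β * m + γ) with hR
  have hδ0 : δ ≠ 0 := by rintro rfl; exact hδ IsSquare.zero
  rcases R.eq_empty_or_nonempty with h | ⟨m₀, hm₀⟩
  · simp [h]
  obtain ⟨y₀, hy₀⟩ := (Finset.mem_filter.1 hm₀).2
  set Z := Finset.univ.filter fun m : ZMod q => δ * m ^ 2 + β * m + γ = 0 with hZ
  have hZc : Z.card ≤ 2 := by
    open Polynomial in
    have hp : (C δ * X ^ 2 + C β * X + C γ : (ZMod q)[X]) ≠ 0 := by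
      intro h
      have := congrArg natDegree h
      rw [natDegree_quadratic hδ0] at this
      simp at this
    have hsub : Z ⊆ (Polynomial.C δ * Polynomial.X ^ 2 + Polynomial.C β * Polynomial.X
        + Polynomial.C γ).roots.toFinset := by
      intro m hm
      simp only [hZ, Finset.mem_filter, Finset.mem_univ, true_and] at hm
      simp [Polynomial.mem_roots hp, hm]
    refine (Finset.card_le_card hsub).trans ((Multiset.toFinset_card_le _).trans ?_)
    exact (Polynomial.card_roots' _).trans (Polynomial.natDegree_quadratic_le)
  have hden : ∀ s : ZMod q, s ^ 2 - δ ≠ 0 := fun s h =>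
    hδ ⟨s, by rw [← sq]; exact (sub_eq_zero.1 h).symm⟩
  let u : ZMod q → ZMod q := fun s => m₀ + (2 * δ * m₀ + β - 2 * y₀ * s) / (s ^ 2 - δ)
  have hu : ∀ m y : ZMod q, y * y = δ * m ^ 2 + β * m + γ → m ≠ m₀ →
      u ((y - y₀) / (m - m₀)) = m := by
    intro m y hy hm
    have hm' : m - m₀ ≠ 0 := sub_ne_zero.2 hm
    have h1 := hden ((y - y₀) / (m - m₀))
    have h2 : (2 * δ * m₀ + β - 2 * y₀ * ((y - y₀) / (m - m₀))) =
        (m - m₀) * (((y - y₀) / (m - m₀)) ^ 2 - δ) := by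
      field_simp
      linear_combination -hy₀ - hy
    simp only [u]
    rw [h2, mul_div_assoc, div_self h1]
    ring
  have h2q : (2 : ZMod q) ≠ 0 := by
    have : ((2 : ℕ) : ZMod q) ≠ 0 := by
      rw [Ne, ZMod.natCast_eq_zero_iff]
      intro h
      have := Nat.le_of_dvd (by norm_num) h
      omega
    simpa using this
  set T := (R \ Z).erase m₀ with hT
  have hfib : ∀ m ∈ T, 2 ≤ ((Finset.univ : Finset (ZMod q)).filter fun s => u s = m).card := by
    intro m hm
    simp only [hT, hR, hZ, Finset.mem_erase, Finset.mem_sdiff, Finset.mem_filter,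
      Finset.mem_univ, true_and] at hm
    obtain ⟨hmm, ⟨y, hy⟩, hm0⟩ := hm
    have hm' : m - m₀ ≠ 0 := sub_ne_zero.2 hmm
    have hy0 : y ≠ 0 := by rintro rfl; exact hm0 (by simpa using hy)
    refine Finset.one_lt_card.2 ⟨(y - y₀) / (m - m₀), ?_, (-y - y₀) / (m - m₀), ?_, ?_⟩
    · simpa using hu m y hy.symm hmm
    · simpa using hu m (-y) (by rw [hy]; ring) hmm
    · intro h
      rw [div_left_inj' hm'] at h
      have h3 : 2 * y = 0 := by linear_combination h
      exact (mul_ne_zero h2q hy0) h3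
  have hcount : 2 * T.card ≤ q := by
    have h1 : ∑ m ∈ T, ((Finset.univ : Finset (ZMod q)).filter fun s => u s = m).card ≤ q := by
      calc _ ≤ ∑ m : ZMod q, ((Finset.univ : Finset (ZMod q)).filter fun s => u s = m).card :=
            Finset.sum_le_sum_of_subset (Finset.subset_univ _)
        _ = (Finset.univ : Finset (ZMod q)).card :=
            (Finset.card_eq_sum_card_fiberwise (fun _ _ => Finset.mem_coe.2 (Finset.mem_univ _))).symm
        _ = q := by simp [ZMod.card]
    have h2 := (Finset.card_nsmul_le_sum T _ 2 hfib).trans h1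
    simpa [mul_comm] using h2
  have h3 : R.card ≤ T.card + 1 + Z.card := by
    have h4 : R.card ≤ (R \ Z).card + Z.card := Finset.card_le_card_sdiff_add_card
    have h5 : (R \ Z).card ≤ T.card + 1 := 
      Nat.sub_le_iff_le_add.1 Finset.pred_card_le_card_erase
    omega
  omega

theorem residueClass_tsum_asymptotic {D : ℕ} [NeZero D] {a : ZMod D} (ha : IsUnit a) :
    ∃ C : ℝ, ∀ x ∈ Set.Ioc (1 : ℝ) 2,
      |∑' n, ArithmeticFunction.vonMangoldt.residueClass a n / (n : ℝ) ^ x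
        - (D.totient : ℝ)⁻¹ / (x - 1)| ≤ C := by
  open Complex LSeries ArithmeticFunction.vonMangoldt in
  have H {x : ℝ} (hx : 1 < x) :
      ∑' n, residueClass a n / (n : ℝ) ^ x =
        (LFunctionResidueClassAux a x).re + (D.totient : ℝ)⁻¹ / (x - 1) := by
    refine ofReal_injective ?_
    simp only [ofReal_tsum, ofReal_div, ofReal_cpow (Nat.cast_nonneg _), ofReal_natCast,
      ofReal_add, ofReal_inv, ofReal_sub, ofReal_one]
    simp_rw [← LFunctionResidueClassAux_real ha hx,
      eqOn_LFunctionResidueClassAux ha <| Set.mem_ofPred.mpr (ofReal_re x ▸ hx), sub_add_cancel,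
      LSeries, term]
    refine tsum_congr fun n ↦ ?_
    split_ifs with hn
    · simp only [hn, residueClass_apply_zero, ofReal_zero, zero_div]
    · rfl
  have hcont : ContinuousOn
      (fun x : ℝ ↦ (ArithmeticFunction.vonMangoldt.LFunctionResidueClassAux a x).re)
      (Set.Icc 1 2) :=
    Complex.continuous_re.continuousOn.comp (t := Set.univ)
      (ArithmeticFunction.vonMangoldt.continuousOn_LFunctionResidueClassAux a)
      (fun ⦃x⦄ a ↦ trivial) |>.comp Complex.continuous_ofReal.continuousOn fun x hx ↦ by
        simpa only [Set.mem_ofPred_eq, Complex.ofReal_re] using hx.1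
  obtain ⟨C, hC⟩ := isCompact_Icc.exists_bound_of_continuousOn hcont
  refine ⟨C, fun x hx => ?_⟩
  rw [H hx.1, add_sub_cancel_right]
  exact hC x (Set.Ioc_subset_Icc_self hx)

open ArithmeticFunction.vonMangoldt in
theorem exists_many_primes_residueClass {D : ℕ} [NeZero D] {a : ZMod D} (ha : IsUnit a)
    {ε : ℝ} (hε : 0 < ε) (hε1 : ε < 1) :
    ∃ K X₀ : ℕ, ∀ X : ℕ, X₀ ≤ X → ∃ Y : ℕ, X < Y ∧ Y ≤ X ^ K ∧
      (Y : ℝ) ^ (1 - ε) ≤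
        ((Finset.Ioc X Y).filter fun q : ℕ => q.Prime ∧ (q : ZMod D) = a).card := by
  obtain ⟨C₀, hC₀⟩ := residueClass_tsum_asymptotic ha
  set c : ℝ := (D.totient : ℝ)⁻¹ with hc
  have hc0 : 0 < c := inv_pos.2 (by exact_mod_cast D.totient_pos.2 (NeZero.pos D))
  set S : ℝ → ℝ := fun x => ∑' n, residueClass a n / (n : ℝ) ^ x with hS
  have hSsum : ∀ x : ℝ, 1 < x → Summable fun n => residueClass a n / (n : ℝ) ^ x := fun x hx =>
    LSeries.summable_real_of_abscissaOfAbsConv_lt <|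
        (abscissaOfAbsConv_residueClass_le_one a).trans_lt <| mod_cast hx
  have hC₀0 : 0 ≤ C₀ := (abs_nonneg _).trans (hC₀ 2 (by norm_num))
  set C : ℝ := c + C₀ with hC
  have hC1 : 0 < C := by positivity
  have hup : ∀ x ∈ Set.Ioc (1 : ℝ) 2, S x ≤ C / (x - 1) := by
    intro x hx
    have h1 := (abs_le.1 (hC₀ x hx)).2
    have hx1 : 0 < x - 1 := by linarith [hx.1]
    have h2 : C₀ ≤ C₀ / (x - 1) := le_div_self hC₀0 hx1 (by linarith [hx.2])
    rw [hC, add_div]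
    simp only [hS]
    linarith
  have hlow : ∀ x ∈ Set.Ioc (1 : ℝ) 2, c / (x - 1) - C₀ ≤ S x := by
    intro x hx
    have h1 := (abs_le.1 (hC₀ x hx)).1
    simp only [hS]
    linarith
  set w : ℕ → ℝ := fun n => (if n.Prime then 0 else residueClass a n) / n with hw
  have hwsum : Summable w := summable_residueClass_non_primes_div a
  obtain ⟨C₁, hC₁⟩ := sum_rpow_neg_le_of_card_le (θ := 1 - ε) (γ := 1 - ε / 2) (c := 1)
    (by linarith) (by linarith) one_pos
  set C₂ : ℝ := C₁ / (ε / 2) with hC₂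
  set W : ℝ := ∑' n, w n with hW
  obtain ⟨η, hη0, hη1, hη⟩ : ∃ η : ℝ, 0 < η ∧ η ≤ 1 ∧ Real.exp 1 * C * η ≤ c / 4 := by
    refine ⟨min 1 (c / 4 / (Real.exp 1 * C)), by positivity, min_le_left _ _, ?_⟩
    calc Real.exp 1 * C * min 1 (c / 4 / (Real.exp 1 * C))
        ≤ Real.exp 1 * C * (c / 4 / (Real.exp 1 * C)) := by gcongr; exact min_le_right _ _
      _ = c / 4 := by field_simp
  obtain ⟨K, hK⟩ : ∃ K : ℕ, 2 * C * Real.exp (-(K * η / 2)) ≤ c / 4 := by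
    have h1 : Filter.Tendsto (fun K : ℕ => 2 * C * Real.exp (-(K * η / 2))) Filter.atTop
        (nhds (2 * C * 0)) := by
      refine Filter.Tendsto.const_mul _ (Real.tendsto_exp_neg_atTop_nhds_zero.comp ?_)
      exact (tendsto_natCast_atTop_atTop.atTop_mul_const hη0).atTop_div_const (by norm_num)
    rw [mul_zero] at h1
    exact ((h1.eventually (gt_mem_nhds (by positivity : (0 : ℝ) < c / 4))).exists).imp
      fun _ h => h.le
  obtain ⟨X₀, hX₀⟩ : ∃ X₀ : ℕ, ∀ X : ℕ, X₀ ≤ X →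
      1 ≤ Real.log X ∧ C₀ + W + C₂ < c / 2 / η * Real.log X := by
    have h1 : Filter.Tendsto (fun X : ℕ => Real.log X) Filter.atTop Filter.atTop :=
      Real.tendsto_log_atTop.comp tendsto_natCast_atTop_atTop
    have h2 : Filter.Tendsto (fun X : ℕ => c / 2 / η * Real.log X) Filter.atTop Filter.atTop :=
      h1.const_mul_atTop (by positivity)
    exact Filter.eventually_atTop.1
      ((h1.eventually_ge_atTop 1).and (h2.eventually_gt_atTop (C₀ + W + C₂)))
  refine ⟨K, X₀, fun X hX => ?_⟩
  obtain ⟨hl1, hlX⟩ := hX₀ X hX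
  by_contra! hcon
  set ℓ : ℝ := Real.log X with hℓ
  have hX0 : 0 < (X : ℝ) := by
    rcases Nat.eq_zero_or_pos X with h | h
    · simp [hℓ, h] at hl1; linarith
    · exact_mod_cast h
  have hX1 : 1 ≤ X := by exact_mod_cast hX0
  set T : Finset ℕ := (Finset.Ioc X (X ^ K)).filter fun q : ℕ => q.Prime ∧ (q : ZMod D) = a with hT
  have hTsum : ∑ n ∈ T, Real.log n / n ≤ C₂ := by
    have h1 : ∑ n ∈ T, (n : ℝ) ^ (-(1 - ε / 2)) ≤ C₁ := by
      refine hC₁ T (fun n hn => ?_) (fun n hn => ?_)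
      · exact (Finset.mem_filter.1 hn).2.1.one_le
      · have hn' := Finset.mem_Ioc.1 (Finset.mem_filter.1 hn).1
        rw [one_mul]
        refine le_trans ?_ (hcon n hn'.1 hn'.2).le
        norm_cast
        refine Finset.card_le_card fun x hx => ?_
        simp only [hT, Finset.mem_filter, Finset.mem_Ioc] at hx ⊢
        exact ⟨⟨hx.1.1.1, hx.2⟩, hx.1.2⟩
    rw [hC₂, le_div_iff₀ (by positivity), Finset.sum_mul]
    refine le_trans (Finset.sum_le_sum fun n hn => ?_) h1
    have hn0 : (0 : ℝ) < n := by exact_mod_cast (Finset.mem_filter.1 hn).2.1.pos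
    have h2 := Real.log_le_rpow_div hn0.le (show 0 < ε / 2 by positivity)
    rw [le_div_iff₀ (by positivity)] at h2
    calc Real.log n / n * (ε / 2) = (Real.log n * (ε / 2)) * (n : ℝ) ^ (-1 : ℝ) := by
          rw [Real.rpow_neg_one]; ring
      _ ≤ (n : ℝ) ^ (ε / 2) * (n : ℝ) ^ (-1 : ℝ) := by gcongr
      _ = _ := by rw [← Real.rpow_add hn0]; ring_nf
  set x : ℝ := 1 + η / ℓ with hx
  have hℓ0 : 0 < ℓ := by linarith
  have hηℓ : 0 < η / ℓ := by positivity
  have hηℓ1 : η / ℓ ≤ 1 := (div_le_one hℓ0).2 (hη1.trans hl1)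
  set x' : ℝ := 1 + 1 / ℓ with hx'
  set x'' : ℝ := 1 + η / ℓ / 2 with hx''
  have hℓ1 : 0 < 1 / ℓ := by positivity
  have hℓ2 : 1 / ℓ ≤ 1 := (div_le_one hℓ0).2 hl1
  have hpt : ∀ n : ℕ, residueClass a n / (n : ℝ) ^ x ≤
      Real.exp 1 * (residueClass a n / (n : ℝ) ^ x')
        + Real.exp (-(K * η / 2)) * (residueClass a n / (n : ℝ) ^ x'')
        + w n + (if n ∈ T then Real.log n / n else 0) := by
    intro n
    have hr := residueClass_nonneg a n
    have hwn : 0 ≤ w n := by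
      simp only [hw]; split_ifs <;> positivity
    have hTn : (0 : ℝ) ≤ if n ∈ T then Real.log n / n else 0 := by
      split_ifs
      · exact div_nonneg (Real.log_natCast_nonneg n) (Nat.cast_nonneg n)
      · exact le_rfl
    have ht1 : 0 ≤ Real.exp 1 * (residueClass a n / (n : ℝ) ^ x') := by positivity
    have ht2 : 0 ≤ Real.exp (-(K * η / 2)) * (residueClass a n / (n : ℝ) ^ x'') := by positivity
    rcases Nat.eq_zero_or_pos n with rfl | hn
    · simp at *
      linarith
    have hn0 : (0 : ℝ) < n := by exact_mod_cast hn
    by_cases h1 : n ≤ X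
    · have hle : residueClass a n / (n : ℝ) ^ x ≤
          Real.exp 1 * (residueClass a n / (n : ℝ) ^ x') := by
        rw [← mul_div_assoc, mul_comm (Real.exp 1), mul_div_assoc, div_eq_mul_inv]
        refine mul_le_mul_of_nonneg_left ?_ hr
        rw [← Real.rpow_neg hn0.le, Real.rpow_def_of_pos hn0, Real.rpow_def_of_pos hn0,
          ← Real.exp_sub, Real.exp_le_exp]
        have hlog : Real.log n ≤ ℓ := Real.log_le_log hn0 (by exact_mod_cast h1)
        have hlog0 : 0 ≤ Real.log n := Real.log_natCast_nonneg n
        have h2 : Real.log n * (1 / ℓ) ≤ 1 := by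
          rw [mul_one_div]; exact (div_le_one hℓ0).2 hlog
        have h3 : 0 ≤ Real.log n * (η / ℓ) := by positivity
        rw [hx, hx']
        linarith
      linarith
    by_cases h2 : X ^ K < n
    · have hle : residueClass a n / (n : ℝ) ^ x ≤
          Real.exp (-(K * η / 2)) * (residueClass a n / (n : ℝ) ^ x'') := by
        rw [← mul_div_assoc, mul_comm (Real.exp _), mul_div_assoc, div_eq_mul_inv]
        refine mul_le_mul_of_nonneg_left ?_ hr
        rw [← Real.rpow_neg hn0.le, Real.rpow_def_of_pos hn0, Real.rpow_def_of_pos hn0,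
          ← Real.exp_sub, Real.exp_le_exp]
        have hlog : K * ℓ ≤ Real.log n := by
          rw [hℓ, ← Real.log_pow]
          exact Real.log_le_log (by positivity) (by exact_mod_cast h2.le)
        have h3 : K * ℓ * (η / ℓ / 2) ≤ Real.log n * (η / ℓ / 2) := by gcongr
        have h4 : K * ℓ * (η / ℓ / 2) = K * η / 2 := by field_simp
        rw [hx, hx'']
        linarith
      linarith
    by_cases h3 : n.Prime ∧ (n : ZMod D) = a
    · have hnT : n ∈ T := by
        simp only [hT, Finset.mem_filter, Finset.mem_Ioc]
        exact ⟨⟨by omega, by omega⟩, h3⟩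
      have hle : residueClass a n / (n : ℝ) ^ x ≤ Real.log n / n := by
        refine div_le_div₀ (Real.log_natCast_nonneg n) ?_ hn0 ?_
        · refine (residueClass_le a n).trans ArithmeticFunction.vonMangoldt_le_log
        · conv_lhs => rw [← Real.rpow_one n]
          exact Real.rpow_le_rpow_of_exponent_le (by exact_mod_cast hn) (by linarith)
      rw [if_pos hnT]
      linarith
    · have hle : residueClass a n / (n : ℝ) ^ x ≤ w n := by
        by_cases h4 : n.Prime
        · have : residueClass a n = 0 :=
            Set.indicator_of_notMem (s := {n : ℕ | (n : ZMod D) = a}) (fun h => h3 ⟨h4, h⟩) _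
          rw [this, zero_div]; exact hwn
        · simp only [hw, if_neg h4]
          refine div_le_div_of_nonneg_left hr hn0 ?_
          conv_lhs => rw [← Real.rpow_one n]
          exact Real.rpow_le_rpow_of_exponent_le (by exact_mod_cast hn) (by linarith)
      linarith
  have hs1 := (hSsum x' (by linarith)).mul_left (Real.exp 1)
  have hs2 := (hSsum x'' (by linarith)).mul_left (Real.exp (-(K * η / 2)))
  have hs3 : HasSum (fun n : ℕ => if n ∈ T then Real.log n / n else 0) (∑ n ∈ T, Real.log n / n) := by
    have := hasSum_sum_of_ne_finset_zero (f := fun n : ℕ => if n ∈ T then Real.log n / n else 0)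
      (s := T) (L := SummationFilter.unconditional ℕ) (fun b hb => if_neg hb)
    rwa [Finset.sum_congr rfl (fun n hn => if_pos hn)] at this
  have hbound : S x ≤ Real.exp 1 * S x' + Real.exp (-(K * η / 2)) * S x'' + W + C₂ := by
    have h1 := Summable.tsum_le_tsum hpt (hSsum x (by linarith))
      (((hs1.add hs2).add hwsum).add hs3.summable)
    rw [Summable.tsum_add ((hs1.add hs2).add hwsum) hs3.summable,
      Summable.tsum_add (hs1.add hs2) hwsum, Summable.tsum_add hs1 hs2, tsum_mul_left,
      tsum_mul_left, hs3.tsum_eq] at h1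
    exact h1.trans (by gcongr)
  have hb0 := hlow x ⟨by linarith, by linarith⟩
  have hb1 := hup x' ⟨by linarith, by linarith⟩
  have hb2 := hup x'' ⟨by linarith, by linarith⟩
  have e0 : c / (x - 1) = c / η * ℓ := by rw [hx, add_sub_cancel_left]; field_simp
  have e1 : C / (x' - 1) = C * ℓ := by rw [hx', add_sub_cancel_left]; field_simp
  have e2 : C / (x'' - 1) = 2 * C / η * ℓ := by rw [hx'', add_sub_cancel_left]; field_simp
  rw [e0] at hb0
  rw [e1] at hb1
  rw [e2] at hb2
  have f1 : Real.exp 1 * S x' ≤ c / 4 / η * ℓ := by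
    calc Real.exp 1 * S x' ≤ Real.exp 1 * (C * ℓ) := by gcongr
      _ = (Real.exp 1 * C * η) / η * ℓ := by field_simp
      _ ≤ _ := by gcongr
  have f2 : Real.exp (-(K * η / 2)) * S x'' ≤ c / 4 / η * ℓ := by
    calc Real.exp (-(K * η / 2)) * S x'' ≤ Real.exp (-(K * η / 2)) * (2 * C / η * ℓ) := by gcongr
      _ = (2 * C * Real.exp (-(K * η / 2))) / η * ℓ := by field_simp
      _ ≤ _ := by gcongr
  have g1 : c / 4 / η * ℓ = c / η * ℓ / 4 := by ring
  have g2 : c / 2 / η * ℓ = c / η * ℓ / 2 := by ring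
  linarith

/-- The sum of `G` over the block of `L` consecutive integers starting at `x`. -/
noncomputable def blockSum (L : ℕ) (G : ℤ → ℝ) (x : ℤ) : ℝ := ∑ h ∈ Finset.range L, G (x + h)

theorem abs_blockSum_le {L : ℕ} {G : ℤ → ℝ} {B : ℝ} (hG : ∀ x, |G x| ≤ B) (x : ℤ) :
    |blockSum L G x| ≤ L * B := by
  refine (Finset.abs_sum_le_sum_abs _ _).trans ((Finset.sum_le_sum fun i _ => hG _).trans ?_)
  simp

theorem blockSum_comm (L t : ℕ) (G : ℤ → ℝ) :
    blockSum t (blockSum L G) = blockSum L (blockSum t G) := by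
  funext x
  simp only [blockSum]
  rw [Finset.sum_comm]
  simp only [add_right_comm]

theorem abs_blockSum_le_of_blockSum_eq_zero {t : ℕ} {G : ℤ → ℝ} {B : ℝ} (ht : 0 < t)
    (hG : ∀ x, |G x| ≤ B) (h0 : blockSum t G = 0) (L : ℕ) (x : ℤ) :
    |blockSum L G x| ≤ t * B := by
  have hB : 0 ≤ B := (abs_nonneg _).trans (hG 0)
  induction L using Nat.strong_induction_on generalizing x with
  | _ L ih =>
    rcases lt_or_ge L t with h | h
    · exact (abs_blockSum_le hG x).trans (by gcongr)
    · obtain ⟨L', rfl⟩ := Nat.exists_eq_add_of_le h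
      have h1 : blockSum (t + L') G x = blockSum t G x + blockSum L' G (x + t) := by
        simp only [blockSum, Finset.sum_range_add]
        push_cast
        simp only [add_assoc]
      rw [h1, h0, Pi.zero_apply, zero_add]
      exact ih L' (by omega) _

theorem abs_iterate_blockSum_le {L : ℕ} {G : ℤ → ℝ} {B : ℝ} (hG : ∀ x, |G x| ≤ B) (k : ℕ) (x : ℤ) :
    |(blockSum L)^[k] G x| ≤ L ^ k * B := by
  induction k generalizing x with
  | zero => simpa using hG x
  | succ k ih =>
    rw [Function.iterate_succ_apply']
    exact (abs_blockSum_le ih x).trans_eq (by ring)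

theorem abs_iterate_blockSum_le_of_blockSum_eq_zero {t : ℕ} {G : ℤ → ℝ} {B : ℝ} (ht : 0 < t)
    (hG : ∀ x, |G x| ≤ B) (h0 : blockSum t G = 0) (L k : ℕ) (x : ℤ) :
    |(blockSum L)^[k] G x| ≤ t ^ k * B := by
  have hz (j : ℕ) : blockSum t ((blockSum L)^[j] G) = 0 := by
    induction j with
    | zero => simpa using h0
    | succ j ih =>
      rw [Function.iterate_succ_apply', blockSum_comm, ih]
      funext y
      simp [blockSum]
  induction k generalizing x with
  | zero => simpa using hG x
  | succ k ih =>
    rw [Function.iterate_succ_apply']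
    exact (abs_blockSum_le_of_blockSum_eq_zero ht ih (hz k) L x).trans_eq (by ring)

theorem iterate_blockSum_sum {ι : Type*} (s : Finset ι) (F : ι → ℤ → ℝ) (L k : ℕ) (x : ℤ) :
    (blockSum L)^[k] (fun m => ∑ i ∈ s, F i m) x = ∑ i ∈ s, (blockSum L)^[k] (F i) x := by
  induction k generalizing x with
  | zero => simp
  | succ k ih =>
    simp only [Function.iterate_succ_apply', blockSum, ih]
    rw [Finset.sum_comm]

theorem pow_mul_sum_le_iterate_blockSum {F : ℤ → ℝ} (hF : ∀ x, 0 ≤ F x) {H L : ℕ} (hHL : H ≤ L)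
    (k : ℕ) (x : ℤ) (A : Finset ℤ) (hA : ∀ m ∈ A, x + k * H ≤ m ∧ m < x + L) :
    (H : ℝ) ^ k * ∑ m ∈ A, F m ≤ (blockSum L)^[k + 1] F x := by
  have hnn (k : ℕ) : ∀ x, 0 ≤ (blockSum L)^[k] F x := by
    induction k with
    | zero => simpa using hF
    | succ k ih =>
      intro x
      rw [Function.iterate_succ_apply']
      exact Finset.sum_nonneg fun i _ => ih _
  induction k generalizing x with
  | zero =>
    have hsub : A ⊆ (Finset.range L).image fun h : ℕ => x + h := by
      intro m hm
      have := hA m hm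
      refine Finset.mem_image.2 ⟨(m - x).toNat, ?_, ?_⟩
      · simp at this ⊢; omega
      · simp at this ⊢; omega
    have h1 := Finset.sum_le_sum_of_subset_of_nonneg hsub (fun i _ _ => hF i)
    rw [Finset.sum_image (fun i _ j _ h => by simpa using h)] at h1
    simpa [blockSum] using h1
  | succ k ih =>
    rw [Function.iterate_succ_apply']
    calc (H : ℝ) ^ (k + 1) * ∑ m ∈ A, F m
        = ∑ h ∈ Finset.range H, (H : ℝ) ^ k * ∑ m ∈ A, F m := by
          rw [Finset.sum_const, Finset.card_range, nsmul_eq_mul]; ring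
      _ ≤ ∑ h ∈ Finset.range H, (blockSum L)^[k + 1] F (x + h) := by
          refine Finset.sum_le_sum fun h hh => ih (x + h) fun m hm => ?_
          have h1 := hA m hm
          have h2 := Finset.mem_range.1 hh
          push_cast at h1
          constructor
          · have : (h : ℤ) ≤ H := by exact_mod_cast h2.le
            linarith
          · have : (0 : ℤ) ≤ h := by positivity
            linarith
      _ ≤ _ := Finset.sum_le_sum_of_subset_of_nonneg (Finset.range_mono hHL)
          (fun i _ _ => hnn (k + 1) _)

theorem card_le_of_blockSum_mul_eq_zero {ι : Type*} (s : Finset ι) (g : ι → ℤ → ℝ)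
    (hg : ∀ i ∈ s, ∀ x, |g i x| ≤ 1) {T : ℕ}
    (hgg : ∀ i ∈ s, ∀ j ∈ s, i ≠ j →
      ∃ t : ℕ, 0 < t ∧ t ≤ T ∧ blockSum t (fun x => g i x * g j x) = 0)
    {δ : ℝ} (hδ : 0 ≤ δ) {H L : ℕ} (hHL : H ≤ L) (k : ℕ) (x : ℤ) (A : Finset ℤ)
    (hA : ∀ m ∈ A, x + k * H ≤ m ∧ m < x + L) (hAg : ∀ m ∈ A, ∀ i ∈ s, δ ≤ g i m) :
    (H : ℝ) ^ k * (A.card * (δ * s.card) ^ 2) ≤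
      s.card * (L : ℝ) ^ (k + 1) + (s.card : ℝ) ^ 2 * (T : ℝ) ^ (k + 1) := by
  classical
  have h1 := pow_mul_sum_le_iterate_blockSum (F := fun m => (∑ i ∈ s, g i m) ^ 2)
    (fun x => sq_nonneg _) hHL k x A hA
  have h2 : (A.card : ℝ) * (δ * s.card) ^ 2 ≤ ∑ m ∈ A, (∑ i ∈ s, g i m) ^ 2 := by
    rw [← nsmul_eq_mul]
    refine Finset.card_nsmul_le_sum _ _ _ fun m hm => ?_
    have := Finset.card_nsmul_le_sum s (fun i => g i m) δ (hAg m hm)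
    rw [nsmul_eq_mul, mul_comm] at this
    gcongr
  refine (mul_le_mul_of_nonneg_left h2 (by positivity)).trans (h1.trans ?_)
  simp only [sq, Finset.sum_mul_sum]
  rw [iterate_blockSum_sum]
  have h3 (i) (hi : i ∈ s) : (blockSum L)^[k + 1] (fun m => ∑ j ∈ s, g i m * g j m) x ≤
      (L : ℝ) ^ (k + 1) + s.card * (T : ℝ) ^ (k + 1) := by
    have hb (j) (hj : j ∈ s) (y : ℤ) : |g i y * g j y| ≤ 1 := by
      rw [abs_mul]; exact mul_le_one₀ (hg i hi y) (abs_nonneg _) (hg j hj y)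
    rw [iterate_blockSum_sum, ← Finset.add_sum_erase s _ hi]
    refine add_le_add ?_ ?_
    · exact (le_abs_self _).trans ((abs_iterate_blockSum_le (hb i hi) _ _).trans_eq (mul_one _))
    · refine (Finset.sum_le_card_nsmul (s.erase i) _ ((T : ℝ) ^ (k + 1)) fun j hj => ?_).trans ?_
      · obtain ⟨t, ht, htT, h0⟩ := hgg i hi j (Finset.mem_of_mem_erase hj)
          (Finset.ne_of_mem_erase hj).symm
        refine (le_abs_self _).trans ((abs_iterate_blockSum_le_of_blockSum_eq_zero ht
          (hb j (Finset.mem_of_mem_erase hj)) h0 L _ _).trans ?_)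
        rw [mul_one]
        gcongr
      · rw [nsmul_eq_mul]
        gcongr
        exact Finset.erase_subset i s
  refine (Finset.sum_le_card_nsmul _ _ _ h3).trans_eq ?_
  rw [nsmul_eq_mul]; ring

theorem blockSum_mul_eq_zero_of_coprime {q t : ℕ} [NeZero q] (hqt : q.Coprime t)
    {G : ZMod q → ℝ} (hG : ∑ z, G z = 0) {h : ℤ → ℝ} (hh : Function.Periodic h (t : ℤ)) :
    blockSum (t * q) (fun x => G (x : ZMod q) * h x) = 0 := by
  have hrange (F : ℕ → ℝ) (n : ℕ) : ∑ i ∈ Finset.range (t * n), F i =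
      ∑ u ∈ Finset.range n, ∑ r ∈ Finset.range t, F (t * u + r) := by
    induction n with
    | zero => simp
    | succ n ih => rw [mul_add_one, Finset.sum_range_add, ih, Finset.sum_range_succ]
  have hsum (F : ZMod q → ℝ) : ∑ u ∈ Finset.range q, F (u : ZMod q) = ∑ z, F z := by
    refine Finset.sum_nbij' (fun u => (u : ZMod q)) ZMod.val (by simp)
      (fun z _ => by simpa using z.val_lt) (fun u hu => ?_) (by simp) (by simp)
    exact ZMod.val_cast_of_lt (Finset.mem_range.1 hu)
  funext x
  simp only [blockSum, Pi.zero_apply]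
  rw [hrange, Finset.sum_comm]
  refine Finset.sum_eq_zero fun r _ => ?_
  have hper (u : ℕ) : h (x + ((t * u + r : ℕ) : ℤ)) = h (x + r) := by
    have := hh.nat_mul u (x + r)
    rw [← this]
    congr 1
    push_cast; ring
  simp only [hper, ← Finset.sum_mul]
  have ht : IsUnit (t : ZMod q) := (ZMod.isUnit_iff_coprime t q).2 hqt.symm
  have key := hsum fun z => G ((x + r : ℤ) + t * z)
  have e : ∑ z : ZMod q, G ((x + r : ℤ) + t * z) = ∑ z, G z :=
    Fintype.sum_bijective (fun z : ZMod q => ((x + r : ℤ) : ZMod q) + t * z)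
      ((AddGroup.addLeft_bijective _).comp (IsUnit.isUnit_iff_mulLeft_bijective.1 ht)) _ _ fun _ => rfl
  rw [e, hG] at key
  rw [show (∑ u ∈ Finset.range q, G ((x + ((t * u + r : ℕ) : ℤ) : ℤ) : ZMod q)) = 0 from ?_, zero_mul]
  rw [← key]
  refine Finset.sum_congr rfl fun u _ => ?_
  congr 1
  push_cast; ring

theorem exists_sieve_function {q : ℕ} (hq : q.Prime) (hq12 : 12 ≤ q) {Δ : ℤ}
    (hΔ : ¬ IsSquare (Δ : ZMod q)) (B D : ℤ) :
    ∃ g : ℤ → ℝ, (∀ x, |g x| ≤ 1) ∧ Function.Periodic g (q : ℤ) ∧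
      (∀ m : ℤ, IsSquare (Δ * m ^ 2 + B * m + D) → 1 / 4 ≤ g m) ∧
      ∀ (t : ℕ) (h : ℤ → ℝ), q.Coprime t → Function.Periodic h (t : ℤ) →
        blockSum (t * q) (fun x => g x * h x) = 0 := by
  classical
  have hfact : Fact q.Prime := ⟨hq⟩
  have hq0 : (0 : ℝ) < q := by exact_mod_cast hq.pos
  set R : Finset (ZMod q) := Finset.univ.filter fun m => IsSquare ((Δ : ZMod q) * m ^ 2 + B * m + D)
  have hR : (R.card : ℝ) / q ≤ 3 / 4 := by
    rw [div_le_div_iff₀ hq0 (by norm_num)]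
    have := card_isSquare_quadratic_le hq12 hΔ (B : ZMod q) D
    have : (4 : ℝ) * R.card ≤ 3 * q := by exact_mod_cast this
    linarith
  have hR0 : 0 ≤ (R.card : ℝ) / q := by positivity
  set G : ZMod q → ℝ := fun z => (if z ∈ R then 1 else 0) - (R.card : ℝ) / q with hG
  refine ⟨fun x => G (x : ZMod q), fun x => ?_, fun x => by simp, fun m hm => ?_, fun t h ht hh => ?_⟩
  · simp only [hG]
    rw [abs_le]
    split_ifs <;> constructor <;> linarith
  · have : (m : ZMod q) ∈ R := by
      refine Finset.mem_filter.2 ⟨Finset.mem_univ _, ?_⟩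
      simpa using hm.map (Int.castRingHom (ZMod q))
    simp only [hG, this, if_true]
    linarith
  · refine blockSum_mul_eq_zero_of_coprime ht ?_ hh
    simp only [hG, Finset.sum_sub_distrib]
    simp [ZMod.card]
    field_simp
    simp

theorem card_isSquare_quadratic_le_of_primes {Δ : ℤ} (B D : ℤ) {P : Finset ℕ} {Y : ℕ}
    (hP : ∀ q ∈ P, q.Prime ∧ 12 ≤ q ∧ q ≤ Y ∧ ¬ IsSquare (Δ : ZMod q)) (j : ℕ) {H L : ℕ}
    (hHL : H ≤ L) (k : ℕ) (x : ℤ) (A : Finset ℤ) (hA : ∀ m ∈ A, x + k * H ≤ m ∧ m < x + L)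
    (hsq : ∀ m ∈ A, IsSquare (Δ * m ^ 2 + B * m + D)) :
    (H : ℝ) ^ k * (A.card * ((1 / 4) ^ j * (P.card.choose j : ℝ)) ^ 2) ≤
      P.card.choose j * (L : ℝ) ^ (k + 1) +
        (P.card.choose j : ℝ) ^ 2 * ((Y : ℝ) ^ (2 * j)) ^ (k + 1) := by
  classical
  have hex : ∀ q, ∃ g : ℤ → ℝ, q ∈ P → ((∀ x, |g x| ≤ 1) ∧ Function.Periodic g (q : ℤ) ∧
      (∀ m : ℤ, IsSquare (Δ * m ^ 2 + B * m + D) → 1 / 4 ≤ g m) ∧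
      ∀ (t : ℕ) (h : ℤ → ℝ), q.Coprime t → Function.Periodic h (t : ℤ) →
        blockSum (t * q) (fun x => g x * h x) = 0) := by
    intro q
    by_cases hq : q ∈ P
    · obtain ⟨h1, h2, -, h3⟩ := hP q hq
      obtain ⟨g, hg⟩ := exists_sieve_function h1 h2 h3 B D
      exact ⟨g, fun _ => hg⟩
    · exact ⟨0, fun h => absurd h hq⟩
  choose g hg using hex
  have hper (S : Finset ℕ) (hS : S ⊆ P) :
      Function.Periodic (fun x => ∏ q ∈ S, g q x) ((∏ q ∈ S, q : ℕ) : ℤ) := by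
    intro x
    refine Finset.prod_congr rfl fun q hq => ?_
    obtain ⟨c, hc⟩ := Finset.dvd_prod_of_mem (fun q : ℕ => q) hq
    have := (hg q (hS hq)).2.1.nat_mul c x
    rw [← this, hc]
    congr 1
    push_cast; ring
  have hle (S) (hS : S ∈ P.powersetCard j) : ∏ q ∈ S, q ≤ Y ^ j := by
    obtain ⟨h1, h2⟩ := Finset.mem_powersetCard.1 hS
    rw [← h2]
    exact Finset.prod_le_pow_card _ _ _ fun q hq => (hP q (h1 hq)).2.2.1
  have hpos (S) (hS : S ⊆ P) : 0 < ∏ q ∈ S, q :=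
    Finset.prod_pos fun q hq => (hP q (hS hq)).1.pos
  have main := card_le_of_blockSum_mul_eq_zero (P.powersetCard j) (fun S x => ∏ q ∈ S, g q x)
    (T := Y ^ (2 * j)) (δ := (1 / 4) ^ j) ?_ ?_ (by positivity) hHL k x A hA ?_
  · simpa [Finset.card_powersetCard] using main
  · intro S hS x
    rw [Finset.abs_prod]
    exact Finset.prod_le_one (fun _ _ => abs_nonneg _) fun q hq =>
      (hg q ((Finset.mem_powersetCard.1 hS).1 hq)).1 x
  · intro S hS S' hS' hne
    obtain ⟨hS1, hS2⟩ := Finset.mem_powersetCard.1 hS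
    obtain ⟨hS1', hS2'⟩ := Finset.mem_powersetCard.1 hS'
    obtain ⟨q, hqS, hqS'⟩ : ∃ q ∈ S, q ∉ S' := by
      by_contra! hcon
      exact hne (Finset.eq_of_subset_of_card_le hcon (by omega))
    refine ⟨(∏ r ∈ S.erase q, r) * (∏ r ∈ S', r) * q, ?_, ?_, ?_⟩
    · have := hpos _ ((Finset.erase_subset q S).trans hS1)
      have := hpos S' hS1'
      have := (hP q (hS1 hqS)).1.pos
      positivity
    · rw [mul_right_comm, Finset.prod_erase_mul S _ hqS, two_mul, pow_add]
      exact Nat.mul_le_mul (hle S hS) (hle S' hS')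
    · have hcop : q.Coprime ((∏ r ∈ S.erase q, r) * ∏ r ∈ S', r) := by
        refine Nat.Coprime.mul_right ?_ ?_ <;> refine Nat.Coprime.prod_right fun r hr => ?_
        · exact (Nat.coprime_primes (hP q (hS1 hqS)).1
            (hP r (hS1 (Finset.mem_of_mem_erase hr))).1).2 (Finset.ne_of_mem_erase hr).symm
        · exact (Nat.coprime_primes (hP q (hS1 hqS)).1 (hP r (hS1' hr)).1).2
            fun h => hqS' (h ▸ hr)
      have h1 := (hg q (hS1 hqS)).2.2.2 _
        (fun x => (∏ r ∈ S.erase q, g r x) * ∏ r ∈ S', g r x) hcop ?_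
      · rw [← h1]
        congr 1
        funext x
        rw [← Finset.mul_prod_erase S _ hqS]
        ring
      · have p1 := (hper _ ((Finset.erase_subset q S).trans hS1)).nat_mul (∏ r ∈ S', r)
        have p2 := (hper S' hS1').nat_mul (∏ r ∈ S.erase q, r)
        rw [mul_comm] at p1
        rw [Nat.cast_mul]
        exact p1.mul p2
  · intro m hm S hS
    obtain ⟨hS1, hS2⟩ := Finset.mem_powersetCard.1 hS
    rw [← hS2, ← Finset.prod_const]
    exact Finset.prod_le_prod (fun _ _ => by norm_num) fun q hq =>
      (hg q (hS1 hq)).2.2.1 m (hsq m hm)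

theorem pow_le_mul_choose {N J j : ℕ} (hj : j ≤ J) (hN : 2 * J ≤ N) :
    (N : ℝ) ^ j ≤ 2 ^ J * J.factorial * N.choose j := by
  have h1 := Nat.pow_le_choose (α := ℝ) j N
  rw [div_le_iff₀ (by positivity)] at h1
  have h2 : (N : ℝ) ≤ 2 * ((N + 1 - j : ℕ) : ℝ) := by exact_mod_cast (by omega)
  calc (N : ℝ) ^ j ≤ (2 * ((N + 1 - j : ℕ) : ℝ)) ^ j := by gcongr
    _ = 2 ^ j * ((N + 1 - j : ℕ) : ℝ) ^ j := mul_pow _ _ _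
    _ ≤ 2 ^ J * (N.choose j * J.factorial) := by
      gcongr
      · norm_num
      · exact h1.trans (by gcongr)
    _ = _ := by ring

theorem card_mul_pow_le_of_primes {Δ : ℤ} (B D : ℤ) {P : Finset ℕ} {Y J j M : ℕ}
    (hP : ∀ q ∈ P, q.Prime ∧ 12 ≤ q ∧ q ≤ Y ∧ ¬ IsSquare (Δ : ZMod q)) (hJ : 1 ≤ J) (hj : j ≤ J)
    (hJY : 2 * J ≤ Y) (hPJ : 2 * J ≤ P.card) (hM : 4 * M < Y ^ (2 * j + 1)) (A : Finset ℤ)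
    (hA : ∀ m ∈ A, |m| ≤ M ∧ IsSquare (Δ * m ^ 2 + B * m + D)) :
    (A.card : ℝ) * (P.card : ℝ) ^ j ≤
      2 * 16 ^ J * (4 * J) ^ J * (2 ^ J * J.factorial) * (Y : ℝ) ^ (2 * j + 1) := by
  set L := Y ^ (2 * j + 1) with hL
  set H := L / (2 * J) with hH
  set s := P.card.choose j with hs
  have hY : 1 ≤ Y := by omega
  have hLJ : 2 * J ≤ L := hJY.trans (Nat.le_self_pow (by omega) Y)
  have hH1 : 1 ≤ H := (Nat.one_le_div_iff (by omega)).2 hLJ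
  have hHL : H * (2 * J) ≤ L := Nat.div_mul_le_self L (2 * J)
  have hLH : L ≤ 4 * J * H := by
    have h1 := Nat.lt_div_mul_add (a := L) (b := 2 * J) (by omega)
    rw [← hH] at h1
    nlinarith
  have hs0 : 0 < s := Nat.choose_pos (by omega)
  have hPY : P.card ≤ Y := by
    have := Finset.card_le_card (s := P) (t := Finset.Icc 1 Y) fun q hq =>
      Finset.mem_Icc.2 ⟨(hP q hq).1.one_le, (hP q hq).2.2.1⟩
    simpa using this
  have hsY : s ≤ Y ^ j := (Nat.choose_le_pow _ _).trans (Nat.pow_le_pow_left hPY j)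
  have key := card_isSquare_quadratic_le_of_primes B D hP j
    (H := H) (L := L) (by nlinarith) J (-M - J * H) A (fun m hm => ?_) fun m hm => (hA m hm).2
  · have hT : (s : ℝ) * ((Y : ℝ) ^ (2 * j)) ^ (J + 1) ≤ (L : ℝ) ^ (J + 1) := by
      have : s * (Y ^ (2 * j)) ^ (J + 1) ≤ L ^ (J + 1) := by
        calc s * (Y ^ (2 * j)) ^ (J + 1) ≤ Y ^ (J + 1) * (Y ^ (2 * j)) ^ (J + 1) := by
              gcongr
              exact hsY.trans (Nat.pow_le_pow_right hY (by omega))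
          _ = L ^ (J + 1) := by rw [hL]; ring
      exact_mod_cast this
    have hs0' : (0 : ℝ) < s := by exact_mod_cast hs0
    have hH0 : (0 : ℝ) < H := by exact_mod_cast hH1
    have h1 : (A.card : ℝ) * s ≤ 2 * 16 ^ J * (4 * J) ^ J * L := by
      have hLH' : (L : ℝ) ^ J ≤ (4 * J) ^ J * (H : ℝ) ^ J := by
        rw [← mul_pow]
        gcongr
        exact_mod_cast hLH
      have h16 : (1 : ℝ) ≤ 16 ^ J * ((1 / 4) ^ j) ^ 2 := by
        rw [← pow_mul, mul_comm j 2, pow_mul]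
        norm_num
        rw [one_div, inv_pow, ← div_eq_mul_inv, one_le_div (by positivity)]
        gcongr
        norm_num
      have h2 : (s * H ^ J : ℝ) * ((A.card : ℝ) * s) ≤
          (s * H ^ J : ℝ) * (2 * 16 ^ J * (4 * J) ^ J * L) := by
        calc (s * H ^ J : ℝ) * ((A.card : ℝ) * s)
            ≤ (16 ^ J * ((1 / 4) ^ j) ^ 2) * ((s * H ^ J : ℝ) * ((A.card : ℝ) * s)) :=
              le_mul_of_one_le_left (by positivity) h16
          _ = 16 ^ J * ((H : ℝ) ^ J * (A.card * ((1 / 4) ^ j * s) ^ 2)) := by ring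
          _ ≤ 16 ^ J * (s * (L : ℝ) ^ (J + 1) + s ^ 2 * ((Y : ℝ) ^ (2 * j)) ^ (J + 1)) := by
              gcongr
          _ = 16 ^ J * (s * (L ^ (J + 1) + s * ((Y : ℝ) ^ (2 * j)) ^ (J + 1))) := by ring
          _ ≤ 16 ^ J * (s * (L ^ (J + 1) + L ^ (J + 1))) := by gcongr
          _ = 2 * 16 ^ J * s * L * L ^ J := by ring
          _ ≤ 2 * 16 ^ J * s * L * ((4 * J) ^ J * H ^ J) := by gcongr
          _ = _ := by ring
      exact le_of_mul_le_mul_left h2 (by positivity)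
    calc (A.card : ℝ) * (P.card : ℝ) ^ j ≤ A.card * (2 ^ J * J.factorial * s) := by
          gcongr
          exact pow_le_mul_choose hj hPJ
      _ = (2 ^ J * J.factorial) * (A.card * s) := by ring
      _ ≤ (2 ^ J * J.factorial) * (2 * 16 ^ J * (4 * J) ^ J * L) := by gcongr
      _ = _ := by rw [hL]; push_cast; ring
  · have h1 := abs_le.1 (hA m hm).1
    have h2 : ((H : ℤ) * (2 * J)) ≤ L := by exact_mod_cast hHL
    have h3 : (4 * M : ℤ) < L := by exact_mod_cast hM
    constructor <;> nlinarith

theorem card_isSquare_quadratic_le_rpow {Δ : ℤ} (h0 : Δ ≠ 0) (hΔ : ¬ IsSquare Δ) {η : ℝ}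
    (hη : 0 < η) (hη2 : η ≤ 1 / 2) :
    ∃ C : ℝ, 0 < C ∧ ∀ (M : ℕ) (_ : 1 ≤ M) (B D : ℤ) (A : Finset ℤ),
      (∀ m ∈ A, |m| ≤ M ∧ IsSquare (Δ * m ^ 2 + B * m + D)) →
        (A.card : ℝ) ≤ C * (M : ℝ) ^ (1 / 2 + η) := by
  obtain ⟨D₀, hD₀, a, ha, hres⟩ := exists_residueClass_nonsquare h0 hΔ
  obtain ⟨K, X₀, hwin⟩ := exists_many_primes_residueClass ha hη (by linarith)
  set θ : ℝ := η / (4 * (K + 1)) with hθ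
  have hθ0 : 0 < θ := by positivity
  have hKθ : 4 * (K * θ) ≤ η := by
    rw [hθ]
    have : 4 * (K * (η / (4 * (K + 1)))) = η * (K / (K + 1)) := by field_simp
    rw [this]
    exact mul_le_of_le_one_right hη.le (by rw [div_le_one (by positivity)]; linarith)
  obtain ⟨J, hJ⟩ := exists_nat_ge (1 / θ)
  have hJ1 : 1 ≤ J := by
    have : (0 : ℝ) < J := lt_of_lt_of_le (by positivity) hJ
    exact_mod_cast this
  set C₁ : ℝ := X₀ + 4 * J ^ 2 + 14 with hC₁
  set C₂ : ℝ := 2 * 16 ^ J * (4 * J) ^ J * (2 ^ J * J.factorial) with hC₂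
  refine ⟨C₂ * (4 * (C₁ ^ K) ^ 2), by positivity, fun M hM B D A hA => ?_⟩
  have hMr : (1 : ℝ) ≤ M := by exact_mod_cast hM
  have hMθ : (1 : ℝ) ≤ (M : ℝ) ^ θ := Real.one_le_rpow hMr hθ0.le
  set X : ℕ := X₀ + 4 * J ^ 2 + 12 + ⌈(M : ℝ) ^ θ⌉₊ with hX
  have hXge : (M : ℝ) ^ θ ≤ X := by
    refine (Nat.le_ceil _).trans ?_
    exact_mod_cast (by omega)
  have hXle : (X : ℝ) ≤ C₁ * (M : ℝ) ^ θ := by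
    have h1 := (Nat.ceil_lt_add_one (a := (M : ℝ) ^ θ) (by positivity)).le
    have h2 : ((X₀ : ℝ) + 4 * J ^ 2 + 13) ≤ ((X₀ : ℝ) + 4 * J ^ 2 + 13) * (M : ℝ) ^ θ :=
      le_mul_of_one_le_right (by positivity) hMθ
    have h3 : (X : ℝ) = X₀ + 4 * J ^ 2 + 12 + ⌈(M : ℝ) ^ θ⌉₊ := by rw [hX]; push_cast; ring
    rw [h3, hC₁]
    linarith
  obtain ⟨Y, hXY, hYX, hcard⟩ := hwin X (by omega)
  set P := (Finset.Ioc X Y).filter fun q : ℕ => q.Prime ∧ (q : ZMod D₀) = a with hP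
  have hY1 : (1 : ℝ) ≤ Y := by exact_mod_cast (by omega)
  have hY0 : (0 : ℝ) < Y := by linarith
  have hYM : (Y : ℝ) ≤ C₁ ^ K * (M : ℝ) ^ (K * θ) := by
    calc (Y : ℝ) ≤ (X : ℝ) ^ K := by exact_mod_cast hYX
      _ ≤ (C₁ * (M : ℝ) ^ θ) ^ K := by gcongr
      _ = _ := by
        rw [mul_pow, ← Real.rpow_natCast ((M : ℝ) ^ θ) K, ← Real.rpow_mul (by positivity), mul_comm θ]
  have hPJ : 2 * J ≤ P.card := by
    have h1 : (2 * J : ℝ) ≤ (Y : ℝ) ^ (1 - η) := by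
      calc (2 * J : ℝ) = ((2 * J : ℝ) ^ (2 : ℝ)) ^ (1 / 2 : ℝ) := by
            rw [← Real.rpow_mul (by positivity)]; norm_num
        _ ≤ (Y : ℝ) ^ (1 / 2 : ℝ) := by
            refine Real.rpow_le_rpow (by positivity) ?_ (by norm_num)
            norm_num
            have : (2 * J) ^ 2 ≤ Y := by rw [mul_pow]; omega
            exact_mod_cast this
        _ ≤ _ := Real.rpow_le_rpow_of_exponent_le hY1 (by linarith)
    exact_mod_cast h1.trans hcard
  have hJM : 4 * M < Y ^ (2 * J + 1) := by
    have h1 : (M : ℝ) ≤ (Y : ℝ) ^ (2 * J) := by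
      have hYθ : (M : ℝ) ^ θ ≤ Y := hXge.trans (by exact_mod_cast hXY.le)
      calc (M : ℝ) = (M : ℝ) ^ (1 : ℝ) := (Real.rpow_one _).symm
        _ ≤ (M : ℝ) ^ (θ * (2 * J : ℕ)) := by
            refine Real.rpow_le_rpow_of_exponent_le hMr ?_
            have := (div_le_iff₀' hθ0).1 hJ
            push_cast
            nlinarith
        _ = ((M : ℝ) ^ θ) ^ (2 * J) := by
            rw [Real.rpow_mul (by positivity), Real.rpow_natCast]
        _ ≤ _ := by gcongr
    have h2 : M ≤ Y ^ (2 * J) := by exact_mod_cast h1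
    rw [pow_succ]
    nlinarith [(by omega : 12 ≤ Y)]
  have hex : ∃ j, 4 * M < Y ^ (2 * j + 1) := ⟨J, hJM⟩
  set j := Nat.find hex with hjdef
  have hj1 : 4 * M < Y ^ (2 * j + 1) := Nat.find_spec hex
  have hjJ : j ≤ J := Nat.find_min' hex hJM
  have hj2 : (Y : ℝ) ^ (2 * j - 1 : ℝ) ≤ 4 * M := by
    rcases Nat.eq_zero_or_pos j with h | h
    · rw [h]
      refine (Real.rpow_le_one_of_one_le_of_nonpos hY1 (by norm_num)).trans (by linarith)
    · have h1 := Nat.find_min hex (m := j - 1) (by omega)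
      have h2 : Y ^ (2 * j - 1) ≤ 4 * M := by
        rw [show 2 * j - 1 = 2 * (j - 1) + 1 by omega]
        exact not_lt.1 h1
      have h3 : ((2 * j - 1 : ℕ) : ℝ) = 2 * j - 1 := by
        rw [Nat.cast_sub (by omega)]; push_cast; ring
      rw [← h3, Real.rpow_natCast]
      exact_mod_cast h2
  have key := card_mul_pow_le_of_primes B D (P := P) (Y := Y) (J := J) (j := j) (M := M)
    (fun q hq => ?_) hJ1 hjJ (by nlinarith) hPJ hj1 A hA
  · have h1 : (A.card : ℝ) * (Y : ℝ) ^ ((1 - η) * j) ≤ C₂ * (Y : ℝ) ^ (2 * j + 1 : ℝ) := by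
      have e1 : (Y : ℝ) ^ ((1 - η) * j) ≤ (P.card : ℝ) ^ j := by
        rw [Real.rpow_mul hY0.le, Real.rpow_natCast]
        gcongr
      have e2 : (Y : ℝ) ^ (2 * j + 1 : ℝ) = (Y : ℝ) ^ (2 * j + 1) := by
        rw [← Real.rpow_natCast]; push_cast; rfl
      rw [e2]
      exact (by gcongr : (A.card : ℝ) * (Y : ℝ) ^ ((1 - η) * j) ≤ A.card * (P.card : ℝ) ^ j).trans key
    have h2 : (A.card : ℝ) ≤ C₂ * (Y : ℝ) ^ (j + 1 + η * j) := by
      have hpos : 0 < (Y : ℝ) ^ ((1 - η) * j) := by positivity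
      refine le_of_mul_le_mul_right (h1.trans_eq ?_) hpos
      rw [mul_assoc C₂, ← Real.rpow_add hY0]
      congr 2
      ring
    refine h2.trans ?_
    rw [mul_assoc C₂]
    refine mul_le_mul_of_nonneg_left ?_ (by positivity)
    calc (Y : ℝ) ^ (j + 1 + η * j)
        = ((Y : ℝ) ^ (2 * j - 1 : ℝ)) ^ (1 / 2 + η / 2) * (Y : ℝ) ^ (3 / 2 + η / 2) := by
          rw [← Real.rpow_mul hY0.le, ← Real.rpow_add hY0]
          congr 1; ring
      _ ≤ (4 * M : ℝ) ^ (1 / 2 + η / 2) * (Y : ℝ) ^ (2 : ℝ) := by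
          gcongr
          linarith
      _ ≤ (4 * (M : ℝ) ^ (1 / 2 + η / 2)) * (C₁ ^ K * (M : ℝ) ^ (K * θ)) ^ (2 : ℝ) := by
          gcongr
          rw [Real.mul_rpow (by norm_num) (by positivity)]
          gcongr
          conv_rhs => rw [← Real.rpow_one 4]
          exact Real.rpow_le_rpow_of_exponent_le (by norm_num) (by linarith)
      _ = 4 * (C₁ ^ K) ^ 2 * (M : ℝ) ^ (1 / 2 + η / 2 + K * θ * 2) := by
          rw [Real.rpow_add (by linarith : (0 : ℝ) < M) (1 / 2 + η / 2) (K * θ * 2),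
            Real.rpow_mul (by positivity) (K * θ), Real.rpow_two, Real.rpow_two]
          ring
      _ ≤ _ := by
          exact mul_le_mul_of_nonneg_left
            (Real.rpow_le_rpow_of_exponent_le hMr (by linarith)) (by positivity)
  · obtain ⟨h1, h2, h3⟩ := Finset.mem_filter.1 hq
    obtain ⟨h4, h5⟩ := Finset.mem_Ioc.1 h1
    exact ⟨h2, by omega, h5, (hres q h2 h3).2⟩

theorem exists_sum_rpow_neg_isSquare_quadratic_le {Δ : ℤ} (h0 : Δ ≠ 0) (hΔ : ¬ IsSquare Δ) {γ : ℝ}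
    (hγ : 1 / 2 < γ) :
    ∃ C : ℝ, ∀ (B D : ℤ) (A : Finset ℤ),
      (∀ m ∈ A, m ≠ 0 ∧ IsSquare (Δ * m ^ 2 + B * m + D)) →
        ∑ m ∈ A, (m.natAbs : ℝ) ^ (-γ) ≤ C := by
  set η : ℝ := min (1 / 2) ((γ - 1 / 2) / 2) with hη
  have hη0 : 0 < η := lt_min (by norm_num) (by linarith)
  have hηγ : 1 / 2 + η < γ := by
    have : η ≤ (γ - 1 / 2) / 2 := min_le_right _ _
    linarith
  obtain ⟨C₀, hC₀, hcount⟩ := card_isSquare_quadratic_le_rpow h0 hΔ hη0 (min_le_left _ _)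
  obtain ⟨C, hC⟩ := sum_rpow_neg_le_of_card_le (by linarith : 0 < 1 / 2 + η) hηγ hC₀
  have main (B D : ℤ) (A : Finset ℤ) (hA : ∀ m ∈ A, m ≠ 0 ∧ IsSquare (Δ * m ^ 2 + B * m + D))
      (hinj : Set.InjOn Int.natAbs (A : Set ℤ)) : ∑ m ∈ A, (m.natAbs : ℝ) ^ (-γ) ≤ C := by
    have h1 := hC (A.image Int.natAbs) ?_ ?_
    · rwa [Finset.sum_image hinj] at h1
    · simp only [Finset.mem_image]
      rintro _ ⟨m, hm, rfl⟩
      exact Int.natAbs_pos.2 (hA m hm).1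
    · simp only [Finset.mem_image]
      rintro _ ⟨m, hm, rfl⟩
      refine le_trans ?_ (hcount m.natAbs (Int.natAbs_pos.2 (hA m hm).1) B D
        (A.filter fun i => i.natAbs ≤ m.natAbs) fun i hi => ?_)
      · rw [Finset.filter_image]
        exact_mod_cast Finset.card_image_le
      · obtain ⟨hi1, hi2⟩ := Finset.mem_filter.1 hi
        refine ⟨?_, (hA i hi1).2⟩
        rw [Int.abs_eq_natAbs]
        exact_mod_cast hi2
  refine ⟨C + C, fun B D A hA => ?_⟩
  rw [← Finset.sum_filter_add_sum_filter_not A (0 < ·)]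
  refine add_le_add (main B D _ (fun m hm => hA m (Finset.mem_of_mem_filter m hm)) ?_)
    (main B D _ (fun m hm => hA m (Finset.mem_of_mem_filter m hm)) ?_) <;>
  · intro x hx y hy hxy
    simp at hx hy hxy
    omega

open scoped Classical in
theorem exists_tsum_isSquare_quadratic_le {Δ : ℤ} (h0 : Δ ≠ 0) (hΔ : ¬ IsSquare Δ) {γ : ℝ}
    (hγ : 1 / 2 < γ) :
    ∃ C : ℝ≥0∞, C ≠ ⊤ ∧ ∀ B D : ℤ,
      ∑' m : {m : ℤ // m ≠ 0}, (if IsSquare (Δ * (m : ℤ) ^ 2 + B * (m : ℤ) + D) then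
        ((m : ℤ).natAbs : ℝ≥0∞) ^ (-γ) else 0) ≤ C := by
  obtain ⟨C, hC⟩ := exists_sum_rpow_neg_isSquare_quadratic_le h0 hΔ hγ
  refine ⟨ENNReal.ofReal C, ENNReal.ofReal_ne_top, fun B D => ?_⟩
  rw [ENNReal.tsum_eq_iSup_sum]
  refine iSup_le fun s => ?_
  have h1 := hC B D ((s.filter fun m : {m : ℤ // m ≠ 0} => IsSquare (Δ * (m : ℤ) ^ 2 + B * (m : ℤ) + D)).map
    (Function.Embedding.subtype _)) ?_
  · rw [Finset.sum_map] at h1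
    refine le_trans (le_of_eq ?_) (ENNReal.ofReal_le_ofReal h1)
    rw [ENNReal.ofReal_sum_of_nonneg fun _ _ => by positivity, Finset.sum_filter]
    refine Finset.sum_congr rfl fun m _ => ?_
    split_ifs
    · rw [Function.Embedding.subtype_apply,
        ← ENNReal.ofReal_rpow_of_pos (by exact_mod_cast Int.natAbs_pos.2 m.2), ENNReal.ofReal_natCast]
    · rfl
  · simp only [Finset.mem_map, Finset.mem_filter]
    rintro _ ⟨m, ⟨-, hm⟩, rfl⟩
    exact ⟨m.2, hm⟩

theorem ENNReal.tsum_mul_rpow_le {ι : Type*} {p : ℝ} (hp : 1 ≤ p) (w x : ι → ℝ≥0∞) :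
    (∑' i, w i * x i) ^ p ≤ (∑' i, w i) ^ (p - 1) * ∑' i, w i * x i ^ p := by
  have hp0 : 0 < p := by linarith
  have h1 : ∑' i, w i * x i ≤ (∑' i, w i) ^ (1 - p⁻¹) * (∑' i, w i * x i ^ p) ^ p⁻¹ := by
    rw [ENNReal.tsum_eq_iSup_sum]
    refine iSup_le fun s => (ENNReal.inner_le_weight_mul_Lp_of_nonneg s hp w x).trans ?_
    have : 0 ≤ 1 - p⁻¹ := sub_nonneg.2 (inv_le_one_of_one_le₀ hp)
    gcongr <;> exact ENNReal.sum_le_tsum s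
  refine (ENNReal.rpow_le_rpow h1 hp0.le).trans_eq ?_
  rw [ENNReal.mul_rpow_of_nonneg _ _ hp0.le, ← ENNReal.rpow_mul, ← ENNReal.rpow_mul,
    inv_mul_cancel₀ hp0.ne', ENNReal.rpow_one, sub_mul, inv_mul_cancel₀ hp0.ne', one_mul]

theorem tsum_natAbs_rpow_neg_ne_top {β : ℝ} (hβ : 1 < β) :
    ∑' m : {m : ℤ // m ≠ 0}, ((m : ℤ).natAbs : ℝ≥0∞) ^ (-β) ≠ ⊤ := by
  have h1 := (Real.summable_abs_int_rpow hβ).comp_injective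
    (Subtype.val_injective (p := fun m : ℤ => m ≠ 0))
  have h2 := h1.tsum_ofReal_ne_top
  refine (tsum_congr fun m => ?_).trans_ne h2
  have : |((m : ℤ) : ℝ)| = ((m : ℤ).natAbs : ℝ) := by
    rw [Nat.cast_natAbs, Int.cast_abs]
  simp only [Function.comp_apply]
  rw [this, ← ENNReal.ofReal_rpow_of_pos (by exact_mod_cast Int.natAbs_pos.2 m.2),
    ENNReal.ofReal_natCast]

open scoped Classical in
theorem tsum_quadratic_eq_le {a b c d e f₀ : ℤ} (hc : c ≠ 0) (m k : ℤ) :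
    ∑' n : ℤ, (if a * m ^ 2 + b * m * n + c * n ^ 2 + d * m + e * n + f₀ = k then (1 : ℝ≥0∞) else 0) ≤
      if IsSquare ((b ^ 2 - 4 * a * c) * m ^ 2 + (2 * b * e - 4 * c * d) * m +
        (e ^ 2 + 4 * c * (k - f₀))) then 2 else 0 := by
  have hid (n : ℤ) (hn : a * m ^ 2 + b * m * n + c * n ^ 2 + d * m + e * n + f₀ = k) :
      (b ^ 2 - 4 * a * c) * m ^ 2 + (2 * b * e - 4 * c * d) * m + (e ^ 2 + 4 * c * (k - f₀)) =
        (2 * c * n + (b * m + e)) * (2 * c * n + (b * m + e)) := by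
    rw [← hn]; ring
  split_ifs with hsq
  · obtain ⟨y, hy⟩ := hsq
    have hinj : Function.Injective fun n : ℤ => 2 * c * n + (b * m + e) := fun n n' h => by
      have : 2 * c * n = 2 * c * n' := add_right_cancel h
      exact mul_left_cancel₀ (mul_ne_zero two_ne_zero hc) this
    have hone (z : ℤ) :
        ∑' n : ℤ, (if 2 * c * n + (b * m + e) = z then (1 : ℝ≥0∞) else 0) ≤ 1 :=
      (ENNReal.tsum_comp_le_tsum_of_injective hinj fun u => if u = z then (1 : ℝ≥0∞) else 0).trans
        (tsum_ite_eq z _).le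
    calc _ ≤ ∑' n : ℤ, ((if 2 * c * n + (b * m + e) = y then (1 : ℝ≥0∞) else 0) +
          if 2 * c * n + (b * m + e) = -y then (1 : ℝ≥0∞) else 0) := by
          refine ENNReal.tsum_le_tsum fun n => ?_
          split_ifs with h1 h2 h3 h3 h2 <;> try simp
          rcases mul_self_eq_mul_self_iff.1 ((hid n h1).symm.trans hy) with h | h
          · exact h2 h
          · exact h3 h
      _ ≤ 1 + 1 := by
          rw [ENNReal.tsum_add]
          exact add_le_add (hone y) (hone (-y))
      _ = 2 := one_add_one_eq_two
  · refine (ENNReal.tsum_eq_zero.2 fun n => ?_).le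
    rw [if_neg fun hn => hsq ⟨_, hid n hn⟩]

open scoped Classical in
theorem tsum_comp_quadratic_le {a b c d e f₀ : ℤ} (hc : c ≠ 0) (m : ℤ) (g : ℤ → ℝ≥0∞) :
    ∑' n : ℤ, g (a * m ^ 2 + b * m * n + c * n ^ 2 + d * m + e * n + f₀) ≤
      2 * ∑' k : ℤ, g k * if IsSquare ((b ^ 2 - 4 * a * c) * m ^ 2 + (2 * b * e - 4 * c * d) * m +
        (e ^ 2 + 4 * c * (k - f₀))) then 1 else 0 := by
  calc _ = ∑' n : ℤ, ∑' k : ℤ, g k *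
        if a * m ^ 2 + b * m * n + c * n ^ 2 + d * m + e * n + f₀ = k then 1 else 0 := by
        refine tsum_congr fun n => ?_
        rw [tsum_eq_single (a * m ^ 2 + b * m * n + c * n ^ 2 + d * m + e * n + f₀)
          fun k hk => by rw [if_neg hk.symm, mul_zero], if_pos rfl, mul_one]
    _ ≤ _ := by
        rw [ENNReal.tsum_comm, ← ENNReal.tsum_mul_left]
        refine ENNReal.tsum_le_tsum fun k => ?_
        rw [ENNReal.tsum_mul_left, mul_left_comm]
        gcongr
        refine (tsum_quadratic_eq_le hc m k).trans ?_
        split_ifs <;> simp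

/-- Discrete fractional integral along an integral bivariate quadratic polynomial
with negative or positive nonsquare discriminant: `ℓ^p` boundedness for
`λ > 1 - 1/(2p)`, with constant depending only on `λ, p, Δ`
(in particular independent of the linear and constant coefficients `d, e, f₀`). -/
theorem stmt_4 (p lam : ℝ) (hp : 1 ≤ p) (hlam : 1 - 1 / (2 * p) < lam)
    (Δ : ℤ) (hΔ : Δ < 0 ∨ (0 < Δ ∧ ¬∃ t : ℤ, t ^ 2 = Δ)) :
    ∃ C : ℝ≥0∞, C ≠ ⊤ ∧
      ∀ a b c d e f₀ : ℤ, b ^ 2 - 4 * a * c = Δ →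
        ∀ f : ℤ → ℝ≥0∞,
          ∑' n : ℤ,
              (∑' m : {m : ℤ // m ≠ 0},
                  f (a * (m : ℤ) ^ 2 + b * (m : ℤ) * n + c * n ^ 2 +
                      d * (m : ℤ) + e * n + f₀) /
                    (((m : ℤ).natAbs : ℝ≥0∞)) ^ lam) ^ p
            ≤ C ^ p * ∑' k : ℤ, f k ^ p := by
  classical
  have hp0 : 0 < p := by linarith
  have h0 : Δ ≠ 0 := by rcases hΔ with h | h <;> omega
  have hsq : ¬ IsSquare Δ := by
    rintro ⟨t, ht⟩
    rcases hΔ with h | h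
    · nlinarith [mul_self_nonneg t]
    · exact h.2 ⟨t, by rw [ht, sq]⟩
  have hgap : 0 < p * lam - p + 1 / 2 := by
    have h1 := mul_lt_mul_of_pos_left hlam hp0
    have h2 : p * (1 - 1 / (2 * p)) = p - 1 / 2 := by field_simp
    linarith
  obtain ⟨β, hβ, hγ⟩ : ∃ β : ℝ, 1 < β ∧ 1 / 2 < p * lam - (p - 1) * β := by
    refine ⟨1 + (p * lam - p + 1 / 2) / (2 * p), by have := div_pos hgap (by positivity : 0 < 2 * p); linarith, ?_⟩
    set τ := (p * lam - p + 1 / 2) / (2 * p) with hτ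
    have hτ0 : 0 < τ := by positivity
    have h1 : 2 * p * τ = p * lam - p + 1 / 2 := by rw [hτ]; field_simp
    nlinarith
  obtain ⟨C', hC', hsum⟩ := exists_tsum_isSquare_quadratic_le h0 hsq hγ
  set W := ∑' m : {m : ℤ // m ≠ 0}, ((m : ℤ).natAbs : ℝ≥0∞) ^ (-β) with hW
  have hWtop : W ≠ ⊤ := tsum_natAbs_rpow_neg_ne_top hβ
  refine ⟨(W ^ (p - 1) * (2 * C')) ^ p⁻¹, ?_, fun a b c d e f₀ hD f => ?_⟩
  · exact ENNReal.rpow_ne_top_of_nonneg (by positivity) (ENNReal.mul_ne_top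
      (ENNReal.rpow_ne_top_of_nonneg (by linarith) hWtop) (ENNReal.mul_ne_top (by simp) hC'))
  have hc : c ≠ 0 := by
    rintro rfl
    exact hsq ⟨b, by rw [← hD]; ring⟩
  rw [← ENNReal.rpow_mul, inv_mul_cancel₀ hp0.ne', ENNReal.rpow_one, mul_assoc]
  have hpt (n : ℤ) : (∑' m : {m : ℤ // m ≠ 0}, f (a * (m : ℤ) ^ 2 + b * (m : ℤ) * n + c * n ^ 2 +
      d * (m : ℤ) + e * n + f₀) / (((m : ℤ).natAbs : ℝ≥0∞)) ^ lam) ^ p ≤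
      W ^ (p - 1) * ∑' m : {m : ℤ // m ≠ 0}, ((m : ℤ).natAbs : ℝ≥0∞) ^ (-(p * lam - (p - 1) * β)) *
        f (a * (m : ℤ) ^ 2 + b * (m : ℤ) * n + c * n ^ 2 + d * (m : ℤ) + e * n + f₀) ^ p := by
    have h1 := ENNReal.tsum_mul_rpow_le hp
      (fun m : {m : ℤ // m ≠ 0} => ((m : ℤ).natAbs : ℝ≥0∞) ^ (-β))
      (fun m => ((m : ℤ).natAbs : ℝ≥0∞) ^ (β - lam) *
        f (a * (m : ℤ) ^ 2 + b * (m : ℤ) * n + c * n ^ 2 + d * (m : ℤ) + e * n + f₀))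
    have hm0 (m : {m : ℤ // m ≠ 0}) : ((m : ℤ).natAbs : ℝ≥0∞) ≠ 0 := by simpa using m.2
    have hmt (m : {m : ℤ // m ≠ 0}) : ((m : ℤ).natAbs : ℝ≥0∞) ≠ ⊤ := ENNReal.natCast_ne_top _
    convert h1 using 4 with m m
    · rw [← mul_assoc, ← ENNReal.rpow_add _ _ (hm0 m) (hmt m), div_eq_mul_inv, mul_comm,
        ← ENNReal.rpow_neg]
      congr 2; ring
    · rw [ENNReal.mul_rpow_of_nonneg _ _ hp0.le, ← mul_assoc, ← ENNReal.rpow_mul,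
        ← ENNReal.rpow_add _ _ (hm0 m) (hmt m)]
      congr 2; ring
  refine (ENNReal.tsum_le_tsum hpt).trans ?_
  rw [ENNReal.tsum_mul_left]
  gcongr
  rw [ENNReal.tsum_comm]
  calc _ ≤ ∑' m : {m : ℤ // m ≠ 0}, ((m : ℤ).natAbs : ℝ≥0∞) ^ (-(p * lam - (p - 1) * β)) *
        (2 * ∑' k : ℤ, f k ^ p * if IsSquare (Δ * (m : ℤ) ^ 2 + (2 * b * e - 4 * c * d) * m +
        (e ^ 2 + 4 * c * (k - f₀))) then 1 else 0) := by
        refine ENNReal.tsum_le_tsum fun m => ?_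
        rw [ENNReal.tsum_mul_left, ← hD]
        gcongr
        exact tsum_comp_quadratic_le hc m fun k => f k ^ p
    _ = ∑' k : ℤ, 2 * f k ^ p * ∑' m : {m : ℤ // m ≠ 0},
        if IsSquare (Δ * (m : ℤ) ^ 2 + (2 * b * e - 4 * c * d) * m + (e ^ 2 + 4 * c * (k - f₀)))
        then ((m : ℤ).natAbs : ℝ≥0∞) ^ (-(p * lam - (p - 1) * β)) else 0 := by
        simp only [← ENNReal.tsum_mul_left]
        rw [ENNReal.tsum_comm]
        refine tsum_congr fun k => tsum_congr fun m => ?_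
        split_ifs <;> ring
    _ ≤ ∑' k : ℤ, 2 * f k ^ p * C' := by
        gcongr with k
        exact hsum _ _
    _ = 2 * C' * ∑' k : ℤ, f k ^ p := by
        rw [← ENNReal.tsum_mul_left]
        exact tsum_congr fun k => by ring
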